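/- Let A = kQ/I be a non simply connected toupie algebra with dim_k e_0 A e_∞ = 0, and let M be an indecomposable A-module viewed as a representation of (Q,I). If M_0 ≠ 0 then the top of M is a direct sum of copies of the simple module S_0 at the source, and if M_∞ ≠ 0 then the socle of M is a direct sum of copies of the simple module S_∞ at the sink. -/

import Mathlib

/-!
Formalization preamble for "Toupie algebras".

We realize the bound quiver algebra `A = kQ/I` of a toupie quiver `Q` concretely:
the path algebra `kQ` is realized, via its (faithful) left regular representation,
as the subalgebra of `Module.End k (paths → k)` generated by the operators of left
multiplication by the trivial paths `e_v` and by the arrows of `Q`.  Paths are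
composed from left to right (`p * q` = "first `p`, then `q`"), as in
Assem–Simson–Skowroński, so that paths from the source `0` to the sink `∞` span
`e₀ (kQ) e∞`, and (right) `A`-modules are identified with representations of `(Q, I)`.
Right `A`-modules are formalized as (left) modules over `Aᵐᵒᵖ`.
-/

set_option synthInstance.maxHeartbeats 400000
set_option maxHeartbeats 800000

noncomputable section
open scoped Classical
open MulOpposite

universe u

namespace Toupie

/-- Vertices of a toupie quiver with `t` branches, branch `i` having length `ℓ i ≥ 1`:
the unique source `src`, the unique sink `snk`, and for each branch `i` its interior
vertices `mid i a` (the `(a+1)`-st vertex on branch `i`, for `a : Fin (ℓ i - 1)`). -/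
inductive Vtx (t : ℕ) (ℓ : Fin t → ℕ) : Type
  | src : Vtx t ℓ
  | snk : Vtx t ℓ
  | mid (i : Fin t) (a : Fin (ℓ i - 1)) : Vtx t ℓ

/-- The `a`-th vertex on branch `i`, for `0 ≤ a ≤ ℓ i`
(`a = 0` is the source, `a = ℓ i` is the sink). -/
def vtx (t : ℕ) (ℓ : Fin t → ℕ) (i : Fin t) (a : ℕ) : Vtx t ℓ :=
  if a = 0 then .src else if h : a - 1 < ℓ i - 1 then .mid i ⟨a - 1, h⟩ else .snk

/-- The paths of a toupie quiver: trivial paths at the vertices, and for each branch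
`i` and `a < b ≤ ℓ i` the path `sub i a b` along branch `i` from its `a`-th vertex to
its `b`-th vertex.  (`sub i 0 (ℓ i)` is the `i`-th branch `w i`.) -/
inductive PIdx (t : ℕ) (ℓ : Fin t → ℕ) : Type
  | vert (v : Vtx t ℓ) : PIdx t ℓ
  | sub (i : Fin t) (a b : ℕ) (hab : a < b) (hb : b ≤ ℓ i) : PIdx t ℓ

variable (k : Type u) [Field k] (t : ℕ) (ℓ : Fin t → ℕ)

/-- The vector space with basis the set of paths of the toupie quiver. -/
abbrev PSp : Type u := PIdx t ℓ → k

variable {t ℓ}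

/-- The starting vertex of a path. -/
def startIdx : PIdx t ℓ → Vtx t ℓ
  | .vert v => v
  | .sub i a _ _ _ => vtx t ℓ i a

/-- Left multiplication by the trivial path (primitive idempotent) `e_v`. -/
def Ev (v : Vtx t ℓ) : Module.End k (PSp k t ℓ) where
  toFun f := fun p => if startIdx p = v then f p else 0
  map_add' f g := by funext p; by_cases h : startIdx p = v <;> simp [h]
  map_smul' c f := by funext p; by_cases h : startIdx p = v <;> simp [h]

/-- Strip the `j`-th arrow of branch `i` (the arrow `vtx i j ⟶ vtx i (j+1)`) from the
front of a path, if possible. -/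
def strip (i : Fin t) (j : ℕ) : PIdx t ℓ → Option (PIdx t ℓ)
  | .vert _ => none
  | .sub i' a b _ hb =>
      if h : i' = i ∧ a = j then
        if hb2 : j + 1 < b then some (.sub i (j + 1) b hb2 (h.1 ▸ hb))
        else some (.vert (vtx t ℓ i b))
      else none

/-- Left multiplication by the `j`-th arrow of branch `i`
(the arrow from `vtx i j` to `vtx i (j+1)`, for `j < ℓ i`; the zero operator for junk `j`). -/
def Ar (i : Fin t) (j : ℕ) : Module.End k (PSp k t ℓ) where
  toFun f := fun p => (strip i j p).elim 0 f
  map_add' f g := by funext p; rcases h : strip i j p with _ | q <;> simp [h]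
  map_smul' c f := by funext p; rcases h : strip i j p with _ | q <;> simp [h]

variable (t ℓ)

/-- The generators of the path algebra: the trivial paths and the arrows. -/
def gens : Set (Module.End k (PSp k t ℓ)) :=
  Set.range (Ev k) ∪ {x | ∃ i j, x = Ar k i j}

/-- The path algebra `kQ` of the toupie quiver, realized as the subalgebra of
`Module.End k (PSp k t ℓ)` generated by left multiplication by trivial paths and arrows. -/
def PathAlg : Subalgebra k (Module.End k (PSp k t ℓ)) :=
  Algebra.adjoin k (gens k t ℓ)

variable {k t ℓ}

/-- The trivial path `e_v` as an element of the path algebra. -/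
def eV (v : Vtx t ℓ) : PathAlg k t ℓ :=
  ⟨Ev k v, Algebra.subset_adjoin (Or.inl ⟨v, rfl⟩)⟩

/-- The `j`-th arrow of branch `i` as an element of the path algebra. -/
def arE (i : Fin t) (j : ℕ) : PathAlg k t ℓ :=
  ⟨Ar k i j, Algebra.subset_adjoin (Or.inr ⟨i, j, rfl⟩)⟩

/-- The path along branch `i` from its `a`-th vertex to its `b`-th vertex, as an element
of the path algebra: the product (composed from left to right) of the arrows
`a → a+1 → ⋯ → b`.  (For `b ≤ a` this is the empty product `1`.) -/
def subE (i : Fin t) (a b : ℕ) : PathAlg k t ℓ :=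
  (((List.range (b - a)).map fun s => arE i (a + s)).prod)

/-- The `i`-th branch `w i` (the path from the source to the sink along branch `i`)
as an element of the path algebra. -/
def wE (i : Fin t) : PathAlg k t ℓ := subE i 0 (ℓ i)

variable {k : Type u} [Field k]

/-- A toupie algebra `A = kQ/I`: a toupie quiver `Q` (a non-linear quiver with a unique
source, a unique sink, and all other vertices having exactly one incoming and one
outgoing arrow, i.e. `t ≥ 2` branches of lengths `ℓ i ≥ 1`), together with an admissible
ideal `I` of the path algebra `kQ`.  Since `Q` is finite and acyclic, the arrow ideal is
nilpotent, so admissibility amounts to `I ⊆ R_Q²`, i.e. every element of `I` is a linear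
combination of paths of length `≥ 2`. -/
structure ToupieAlg (k : Type u) [Field k] : Type u where
  t : ℕ
  ht : 2 ≤ t
  ℓ : Fin t → ℕ
  hℓ : ∀ i, 1 ≤ ℓ i
  I : TwoSidedIdeal (PathAlg k t ℓ)
  adm : ∀ x ∈ I, x ∈ Submodule.span k
    {y : PathAlg k t ℓ | ∃ i a b, a + 2 ≤ b ∧ b ≤ ℓ i ∧ y = subE i a b}

variable (T : ToupieAlg k)

/-- The underlying algebra `A = kQ/I` of a toupie algebra. -/
def Alg : Type u := T.I.ringCon.Quotient

instance : Ring (Alg T) := inferInstanceAs (Ring T.I.ringCon.Quotient)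

/-- The quotient map `kQ → A = kQ/I`. -/
def mkA : PathAlg k T.t T.ℓ →+* Alg T := T.I.ringCon.mk'

lemma mkA_surjective : Function.Surjective (mkA T) := Quotient.mk''_surjective

instance : Algebra k (Alg T) :=
  RingHom.toAlgebra' ((mkA T).comp (algebraMap k (PathAlg k T.t T.ℓ)))
    (by
      intro c x
      obtain ⟨y, rfl⟩ := mkA_surjective T x
      simp only [RingHom.coe_comp, Function.comp_apply, ← map_mul]
      rw [Algebra.commutes])

/-- The idempotent `e₀` (at the source) in `A`. -/
def e0 : Alg T := mkA T (eV Vtx.src)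

/-- The idempotent `e∞` (at the sink) in `A`. -/
def einf : Alg T := mkA T (eV Vtx.snk)

/-- The `k`-linear map `A → A`, `x ↦ e₀ * x * e∞`, whose range is `e₀ A e∞`. -/
def lrMap : Alg T →ₗ[k] Alg T where
  toFun x := e0 T * x * einf T
  map_add' x y := by simp [mul_add, add_mul]
  map_smul' c x := by
    simp only [RingHom.id_apply]
    rw [mul_smul_comm, smul_mul_assoc]

/-- `m = dim_k e₀ A e∞`, the dimension of the span of the (residues of the) paths from
the source to the sink. -/
def mDim : ℕ := Module.finrank k ↥(LinearMap.range (lrMap T))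

/-- The branch `w i` lies in the ideal `I`. -/
def branchInI (i : Fin T.t) : Prop := wE i ∈ T.I

/-- A minimal relation: `∑_{i ∈ J} λ i • w i ∈ I` with `|J| ≥ 2`, all `λ i ≠ 0`, and no
nonempty proper subsum in `I`. -/
def MinRel (J : Finset (Fin T.t)) (lam : Fin T.t → k) : Prop :=
  2 ≤ J.card ∧ (∀ i ∈ J, lam i ≠ 0) ∧ (∑ i ∈ J, lam i • wE i) ∈ T.I ∧
    ∀ J' ⊂ J, J'.Nonempty → (∑ i ∈ J', lam i • wE i) ∉ T.I

/-- A toupie algebra is simply connected if any two distinct branches are involved in a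
common minimal relation. -/
def SimplyConnected : Prop :=
  ∀ i j : Fin T.t, i ≠ j → ∃ J lam, MinRel T J lam ∧ i ∈ J ∧ j ∈ J

/-- A (minimal) zero-relation on branch `i`: the subpath of branch `i` from its `a`-th
to its `b`-th vertex lies in `I`, but no proper subpath of it does. -/
def ZeroRel (i : Fin T.t) (a b : ℕ) : Prop :=
  a < b ∧ b ≤ T.ℓ i ∧ subE i a b ∈ T.I ∧
    ∀ a' b', a ≤ a' → b' ≤ b → a' < b' → (a', b') ≠ (a, b) → subE i a' b' ∉ T.I

/-- There is exactly one relation on branch `i`. -/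
def ExactlyOneRel (i : Fin T.t) : Prop := ∃! p : ℕ × ℕ, ZeroRel T i p.1 p.2

/-- Branch `i` carries more than one relation. -/
def MoreThanOneRel (i : Fin T.t) : Prop :=
  ∃ p q : ℕ × ℕ, p ≠ q ∧ ZeroRel T i p.1 p.2 ∧ ZeroRel T i q.1 q.2

/-- At most one branch of `Q` has length at least three. -/
def AtMostOneLongBranch : Prop := ∀ i j : Fin T.t, 3 ≤ T.ℓ i → 3 ≤ T.ℓ j → i = j

/-- The two-sided ideal `I` is generated by the set `S`. -/
def IsGenBy {R : Type u} [Ring R] (I : TwoSidedIdeal R) (S : Set R) : Prop :=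
  S ⊆ (I : Set R) ∧ ∀ J : TwoSidedIdeal R, S ⊆ (J : Set R) → (I : Set R) ⊆ (J : Set R)

/-- A toupie algebra is canonical if (after choosing two distinguished branches `i₁, i₂`)
its ideal is generated by `{w i₁ + λ j • w i₂ - w j}` over the remaining branches `j`,
with the `λ j` pairwise distinct and nonzero. -/
def IsCanonical : Prop :=
  ∃ (i₁ i₂ : Fin T.t) (lam : Fin T.t → k), i₁ ≠ i₂ ∧
    (∀ j, j ≠ i₁ → j ≠ i₂ → lam j ≠ 0) ∧
    (∀ j j', j ≠ i₁ → j ≠ i₂ → j' ≠ i₁ → j' ≠ i₂ → j ≠ j' → lam j ≠ lam j') ∧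
    IsGenBy T.I {x | ∃ j, j ≠ i₁ ∧ j ≠ i₂ ∧ x = wE i₁ + lam j • wE i₂ - wE j}

end Toupie
namespace Toupie

/-! ### Module-theoretic notions over an arbitrary ring

Following the paper, all modules are finite-dimensional *right* modules; a right
`A`-module is formalized as a (left) module over `Aᵐᵒᵖ`.  The definitions below are
stated for modules over an arbitrary ring `R` and are applied with `R := Aᵐᵒᵖ`. -/

variable (R : Type u) [Ring R]

/-- A module is indecomposable if it is nonzero and its only idempotent endomorphisms
are `0` and the identity. -/
def Indec (M : ModuleCat.{u} R) : Prop :=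
  Nontrivial M ∧ ∀ f : M →ₗ[R] M, f.comp f = f → f = 0 ∨ f = LinearMap.id

/-- Finiteness ("finite dimensionality") of a module. -/
def FdMod (M : ModuleCat.{u} R) : Prop := Module.Finite R M

/-- `M` has projective dimension at most one: it is the quotient of a projective module
by a projective submodule. -/
def PdLeOne (M : ModuleCat.{u} R) : Prop :=
  ∃ (P : ModuleCat.{u} R) (f : P →ₗ[R] M), Function.Surjective f ∧
    Module.Projective R P ∧ Module.Projective R ↥(LinearMap.ker f)

/-- `M` has injective dimension at most one: it embeds in an injective module with
injective cokernel. -/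
def IdLeOne (M : ModuleCat.{u} R) : Prop :=
  ∃ (E : ModuleCat.{u} R) (f : M →ₗ[R] E), Function.Injective f ∧
    Module.Injective R E ∧ Module.Injective R (E ⧸ LinearMap.range f)

/-- One step of a path in `ind R`: a nonzero non-isomorphism between (finite-dimensional)
indecomposable modules. -/
def Step (M N : ModuleCat.{u} R) : Prop :=
  Indec R M ∧ FdMod R M ∧ Indec R N ∧ FdMod R N ∧
    ∃ f : M →ₗ[R] N, f ≠ 0 ∧ ¬ Function.Bijective f

/-- A path in `ind R` from `M` to `N` (possibly trivial): a chain
`M = M₀ → M₁ → ⋯ → Mₙ = N` of nonzero non-isomorphisms between indecomposables. -/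
def IndPath (M N : ModuleCat.{u} R) : Prop := Relation.ReflTransGen (Step R) M N

/-- The left part `L_R`: the indecomposable (finite-dimensional) modules `M` such that
every indecomposable `X` with a path `X ⇝ M` in `ind R` has projective dimension `≤ 1`. -/
def InLeftPart (M : ModuleCat.{u} R) : Prop :=
  Indec R M ∧ FdMod R M ∧
    ∀ X : ModuleCat.{u} R, Indec R X → FdMod R X → IndPath R X M → PdLeOne R X

/-- The right part `R_R`: the indecomposable (finite-dimensional) modules `M` such that
every indecomposable `X` with a path `M ⇝ X` in `ind R` has injective dimension `≤ 1`. -/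
def InRightPart (M : ModuleCat.{u} R) : Prop :=
  Indec R M ∧ FdMod R M ∧
    ∀ X : ModuleCat.{u} R, Indec R X → FdMod R X → IndPath R M X → IdLeOne R X

/-- Hereditary: global dimension at most one, i.e. every module has projective dimension
at most one. -/
def Hereditary : Prop := ∀ M : ModuleCat.{u} R, PdLeOne R M

/-- Quasitilted: every indecomposable projective module lies in the left part. -/
def Quasitilted : Prop :=
  ∀ P : ModuleCat.{u} R, Indec R P → FdMod R P → Module.Projective R P → InLeftPart R P

/-- A module is directed if it lies on no cycle of nonzero non-isomorphisms between
indecomposables in `ind R`. -/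
def Directed (M : ModuleCat.{u} R) : Prop := ¬ Relation.TransGen (Step R) M M

/-- Weakly shod: every indecomposable (finite-dimensional) module not lying in
`L_R ∪ R_R` is directed. -/
def WeaklyShod : Prop :=
  ∀ M : ModuleCat.{u} R, Indec R M → FdMod R M →
    ¬ InLeftPart R M → ¬ InRightPart R M → Directed R M

/-- Laura: all but finitely many isomorphism classes of indecomposable
(finite-dimensional) modules lie in `L_R ∪ R_R`. -/
def Laura : Prop :=
  ∃ S : Set (ModuleCat.{u} R), S.Finite ∧
    ∀ M : ModuleCat.{u} R, Indec R M → FdMod R M →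
      ¬ InLeftPart R M → ¬ InRightPart R M → ∃ N ∈ S, Nonempty (M ≃ₗ[R] N)

/-- There are exactly `n` isomorphism classes of modules satisfying `P`. -/
def NumClasses (P : ModuleCat.{u} R → Prop) (n : ℕ) : Prop :=
  ∃ f : Fin n → ModuleCat.{u} R, (∀ i, P (f i)) ∧
    (∀ i j, Nonempty ((f i : Type u) ≃ₗ[R] (f j : Type u)) → i = j) ∧
    ∀ M : ModuleCat.{u} R, P M → ∃ i, Nonempty ((M : Type u) ≃ₗ[R] (f i : Type u))

/-- `M` is (isomorphic to) a direct summand of `T`. -/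
def IsSummandOf (T : Type u) [AddCommGroup T] [Module R T] (M : ModuleCat.{u} R) : Prop :=
  ∃ N N' : Submodule R T, IsCompl N N' ∧ Nonempty ((M : Type u) ≃ₗ[R] N)

/-- `Ext¹_R(T, T) = 0`: every self-extension `0 → T → E → T → 0` splits. -/
def SelfExtVanish (T : Type u) [AddCommGroup T] [Module R T] : Prop :=
  ∀ (E : Type u) [AddCommGroup E] [Module R E] (ι : T →ₗ[R] E) (π : E →ₗ[R] T),
    Function.Injective ι → Function.Surjective π → LinearMap.range ι = LinearMap.ker π →
      ∃ s : T →ₗ[R] E, π.comp s = LinearMap.id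

/-- A tilting module over a hereditary algebra: a finite module with `Ext¹(T,T) = 0`
having as many pairwise non-isomorphic indecomposable direct summands as there are
simple modules. -/
def IsTiltingMod (T : Type u) [AddCommGroup T] [Module R T] : Prop :=
  Module.Finite R T ∧ SelfExtVanish R T ∧
    ∃ n : ℕ, NumClasses R (fun M => Indec R M ∧ IsSummandOf R T M) n ∧
      NumClasses R (fun M => IsSimpleModule R M) n

variable (k : Type u) [Field k]

/-- A `k`-algebra `A` is tilted if it is the endomorphism algebra of a tilting (right)
module over a hereditary finite-dimensional `k`-algebra `H`.  (Right `H`-modules are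
modules over `Hᵐᵒᵖ`; the isomorphism `A ≅ End_H T` is a `k`-linear ring isomorphism.) -/
def IsTilted (A : Type u) [Ring A] [Algebra k A] : Prop :=
  ∃ (H : Type u) (_ : Ring H) (_ : Algebra k H),
    FiniteDimensional k H ∧ Hereditary Hᵐᵒᵖ ∧
      ∃ (T : Type u) (_ : AddCommGroup T) (_ : Module Hᵐᵒᵖ T),
        IsTiltingMod Hᵐᵒᵖ T ∧
          ∃ (_ : Module k T) (_ : SMulCommClass Hᵐᵒᵖ k T) (_ : IsScalarTower k Hᵐᵒᵖ T)
            (φ : A ≃+* Module.End Hᵐᵒᵖ T), ∀ (c : k) (x : A), φ (c • x) = c • φ x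

end Toupie
namespace Toupie

variable {k : Type u} [Field k] (T : ToupieAlg k)

/-! ### Right `A`-modules as representations of `(Q, I)`

For a right `A`-module `M` (a module over `Aᵐᵒᵖ`) and a vertex `v`, the space of the
corresponding representation at `v` is `M_v = M • e_v`. -/

/-- The action of the idempotent `e_v ∈ A` on a right `A`-module (= `Aᵐᵒᵖ`-module). -/
def actV (v : Vtx T.t T.ℓ) : (Alg T)ᵐᵒᵖ := op (mkA T (eV v))

/-- The space `M_v = M • e_v` of the representation `M` at the vertex `v` is zero. -/
def VanishAt (M : ModuleCat.{u} (Alg T)ᵐᵒᵖ) (v : Vtx T.t T.ℓ) : Prop :=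
  ∀ m : M, actV T v • m = 0

/-- Every simple summand of `top M = M / rad M` is one of the simple modules `S_v`,
`v ∈ vs`: for every maximal submodule `N` the simple quotient `M/N` is supported at some
vertex of `vs` (for an admissible quotient of a path algebra, the simple module `S_v` is
the unique simple on which `e_v` acts nontrivially). -/
def TopIn (M : ModuleCat.{u} (Alg T)ᵐᵒᵖ) (vs : Set (Vtx T.t T.ℓ)) : Prop :=
  ∀ N : Submodule (Alg T)ᵐᵒᵖ M, IsCoatom N → ∃ v ∈ vs, ∃ m : M, actV T v • m ∉ N

/-- Every simple summand of the socle of `M` is one of the simple modules `S_v`,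
`v ∈ vs`: every simple submodule `N ≤ M` is supported at some vertex of `vs`. -/
def SocIn (M : ModuleCat.{u} (Alg T)ᵐᵒᵖ) (vs : Set (Vtx T.t T.ℓ)) : Prop :=
  ∀ N : Submodule (Alg T)ᵐᵒᵖ M, IsAtom N → ∃ v ∈ vs, ∃ m ∈ N, actV T v • m ≠ 0

/-- The module `D x y` (for two positions `0 ≤ x, y ≤ ℓ i₀` on the unique branch `i₀`
lying in `I`, and an auxiliary branch `i₂ ≠ i₀`): the right `A`-module with generators
`g = e₀` (at the source) and `h = e_y` (at the `y`-th vertex of branch `i₀`), subject to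
the relations `g ⬝ (subpath of w i₀ from 0 to x+1) = 0` and
`g ⬝ w i₂ = h ⬝ (subpath of w i₀ from y to ℓ i₀)`.  It is presented as the quotient of
the right regular module `A ⊕ A` by the right submodule generated by
`(1 - e₀, 0)`, `(0, 1 - e_y)`, `(subE i₀ 0 (min (x+1) (ℓ i₀)), 0)` and
`(w i₂, - subE i₀ y (ℓ i₀))`. -/
abbrev Dmod (i₀ i₂ : Fin T.t) (x y : ℕ) : Type u :=
  (Alg T × Alg T) ⧸ Submodule.span (Alg T)ᵐᵒᵖ
    ({((mkA T (1 - eV Vtx.src) : Alg T), (0 : Alg T)),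
      ((0 : Alg T), (mkA T (1 - eV (vtx T.t T.ℓ i₀ y)) : Alg T)),
      ((mkA T (subE i₀ 0 (min (x + 1) (T.ℓ i₀))) : Alg T), (0 : Alg T)),
      ((mkA T (wE i₂) : Alg T), (- mkA T (subE i₀ y (T.ℓ i₀)) : Alg T))} :
        Set (Alg T × Alg T))

end Toupie

namespace Toupie

section Chains

variable {k M : Type*} [Field k] [AddCommGroup M] [Module k M]

theorem exists_relative_compl_extending {D G V : Submodule k M} (hDG : Disjoint D G)
    (hD : D ≤ V) (hG : G ≤ V) : ∃ C, D ≤ C ∧ C ⊓ G = ⊥ ∧ C ⊔ G = V := by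
  obtain ⟨a, ha, hc⟩ := hDG.exists_isCompl
  refine ⟨a ⊓ V, le_inf ha hD, ?_, ?_⟩
  · exact (hc.disjoint.mono_left inf_le_left).eq_bot
  · rw [inf_comm, inf_sup_assoc_of_le _ hG, hc.sup_eq_top, inf_top_eq]

theorem exists_chain_compl_of_comap_le (n : ℕ) :
    ∀ (V G : ℕ → Submodule k M) (α : ℕ → M →ₗ[k] M) (C₀ : Submodule k M),
      (∀ j ≤ n, G j ≤ V j) → (∀ j < n, (V j).map (α j) ≤ V (j + 1)) →
      (∀ j < n, V j ⊓ (G (j + 1)).comap (α j) ≤ G j) →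
      C₀ ⊓ G 0 = ⊥ → C₀ ⊔ G 0 = V 0 →
      ∃ C : ℕ → Submodule k M, C 0 = C₀ ∧ (∀ j ≤ n, C j ⊓ G j = ⊥ ∧ C j ⊔ G j = V j) ∧
        ∀ j < n, (C j).map (α j) ≤ C (j + 1) := by
  induction n with
  | zero =>
    intro V G α C₀ _ _ _ h₁ h₂
    refine ⟨fun _ => C₀, rfl, fun j hj => ?_, fun j hj => absurd hj (Nat.not_lt_zero j)⟩
    obtain rfl : j = 0 := by omega
    exact ⟨h₁, h₂⟩
  | succ n ih =>
    intro V G α C₀ hG hV hK h₁ h₂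
    have hle : C₀ ≤ V 0 := h₂ ▸ le_sup_left
    have hdisj : Disjoint (C₀.map (α 0)) (G 1) := by
      rw [Submodule.disjoint_def]
      rintro _ ⟨x, hx, rfl⟩ hx'
      have : x ∈ C₀ ⊓ G 0 := ⟨hx, hK 0 (by omega) ⟨hle hx, hx'⟩⟩
      rw [h₁, Submodule.mem_bot] at this
      simp [this]
    obtain ⟨C₁, hC₁, h₁', h₂'⟩ := exists_relative_compl_extending hdisj
      ((Submodule.map_mono hle).trans (hV 0 (by omega))) (hG 1 (by omega))
    obtain ⟨C, hC0, hC, hCα⟩ := ih (fun j => V (j + 1)) (fun j => G (j + 1))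
      (fun j => α (j + 1)) C₁ (fun j hj => hG _ (by omega)) (fun j hj => hV _ (by omega))
      (fun j hj => hK _ (by omega)) h₁' h₂'
    refine ⟨fun j => Nat.casesOn j C₀ C, rfl, ?_, ?_⟩
    · rintro (_ | j) hj
      · exact ⟨h₁, h₂⟩
      · exact hC j (by omega)
    · rintro (_ | j) hj
      · simpa [hC0] using hC₁
      · exact hCα j (by omega)

theorem exists_chain_compl_of_le_map (n : ℕ) :
    ∀ (V G : ℕ → Submodule k M) (α : ℕ → M →ₗ[k] M),
      (∀ j ≤ n, G j ≤ V j) → (∀ j < n, (V j).map (α j) ≤ V (j + 1)) →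
      (∀ j < n, G (j + 1) ≤ (G j).map (α j)) →
      ∃ C : ℕ → Submodule k M, (∀ j ≤ n, C j ⊓ G j = ⊥ ∧ C j ⊔ G j = V j) ∧
        ∀ j < n, (C j).map (α j) ≤ C (j + 1) := by
  induction n with
  | zero =>
    intro V G α hG _ _
    obtain ⟨C₀, -, h₁, h₂⟩ := exists_relative_compl_extending
      (disjoint_bot_left (a := G 0)) bot_le (hG 0 le_rfl)
    refine ⟨fun _ => C₀, fun j hj => ?_, fun j hj => absurd hj (Nat.not_lt_zero j)⟩
    obtain rfl : j = 0 := by omega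
    exact ⟨h₁, h₂⟩
  | succ n ih =>
    intro V G α hG hV hS
    obtain ⟨C, hC, hCα⟩ := ih (fun j => V (j + 1)) (fun j => G (j + 1))
      (fun j => α (j + 1)) (fun j hj => hG _ (by omega)) (fun j hj => hV _ (by omega))
      (fun j hj => hS _ (by omega))
    set X := V 0 ⊓ (C 0).comap (α 0)
    obtain ⟨C₀, -, h₁, h₂⟩ := exists_relative_compl_extending
      (disjoint_bot_left (a := G 0 ⊓ X)) bot_le inf_le_right
    have hX : C₀ ≤ X := h₂ ▸ le_sup_left
    have hXG : X ⊔ G 0 = V 0 := by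
      refine le_antisymm (sup_le inf_le_left (hG 0 (by omega))) fun v hv => ?_
      have hv' : α 0 v ∈ C 0 ⊔ G (0 + 1) :=
        (hC 0 (by omega)).2 ▸ hV 0 (by omega) (Submodule.mem_map_of_mem hv)
      obtain ⟨c, hc, g, hg, hcg⟩ := Submodule.mem_sup.1 hv'
      obtain ⟨g', hg', rfl⟩ := hS 0 (by omega) hg
      refine Submodule.mem_sup.2 ⟨v - g', ⟨sub_mem hv (hG 0 (by omega) hg'), ?_⟩, g', hg',
        sub_add_cancel _ _⟩
      change α 0 (v - g') ∈ C 0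
      rwa [map_sub, ← hcg, add_sub_cancel_right]
    refine ⟨fun j => Nat.casesOn j C₀ C, ?_, ?_⟩
    · rintro (_ | j) hj
      · refine ⟨?_, ?_⟩
        · rw [eq_bot_iff, ← h₁]
          exact fun x hx => ⟨hx.1, hx.2, hX hx.1⟩
        · change C₀ ⊔ G 0 = V 0
          rw [← hXG, ← h₂, sup_assoc, sup_eq_right.2 (inf_le_left : G 0 ⊓ X ≤ G 0)]
      · exact hC j (by omega)
    · rintro (_ | j) hj
      · exact Submodule.map_le_iff_le_comap.2 (hX.trans inf_le_right)
      · exact hCα j (by omega)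

end Chains

section PathAlgebra

variable {t : ℕ} {ℓ : Fin t → ℕ}

instance : Finite (Vtx t ℓ) :=
  Finite.of_surjective
    (fun x : Option (Option (Σ i : Fin t, Fin (ℓ i - 1))) =>
      match x with
      | none => Vtx.src
      | some none => Vtx.snk
      | some (some p) => Vtx.mid p.1 p.2)
    (by
      rintro (_ | _ | ⟨i, a⟩)
      exacts [⟨none, rfl⟩, ⟨some none, rfl⟩, ⟨some (some ⟨i, a⟩), rfl⟩])

instance : Fintype (Vtx t ℓ) := Fintype.ofFinite _

instance : Finite (PIdx t ℓ) :=
  Finite.of_injective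
    (fun p : PIdx t ℓ =>
      (match p with
      | .vert v => Sum.inl v
      | .sub i a b _ hb => Sum.inr ⟨i, ⟨a, by omega⟩, ⟨b, by omega⟩⟩ :
        Vtx t ℓ ⊕ (Σ i : Fin t, Fin (ℓ i + 1) × Fin (ℓ i + 1))))
    (by
      rintro (v | ⟨i, a, b, _, _⟩) (w | ⟨j, c, d, _, _⟩) h
      · simpa using h
      · simp at h
      · simp at h
      · simp only [Sum.inr.injEq, Sigma.mk.injEq] at h
        obtain ⟨rfl, h⟩ := h
        simpa using h)

theorem vtx_zero (i : Fin t) : vtx t ℓ i 0 = .src := by simp [vtx]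

theorem vtx_length (i : Fin t) (h : 1 ≤ ℓ i) : vtx t ℓ i (ℓ i) = .snk := by
  simp [vtx, Nat.one_le_iff_ne_zero.1 h]

theorem vtx_eq_vtx {i i' : Fin t} {j j' : ℕ} (hj : j ≤ ℓ i) (hj' : j' ≤ ℓ i')
    (h : vtx t ℓ i j = vtx t ℓ i' j') :
    (i = i' ∧ j = j') ∨ (j = 0 ∧ j' = 0) ∨ (j = ℓ i ∧ j' = ℓ i') := by
  unfold vtx at h
  split_ifs at h with h₁ h₂ h₃ h₄ h₅ h₆ h₇
  · simp [h₁, h₂]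
  · simp only [Vtx.mid.injEq] at h
    obtain ⟨rfl, h⟩ := h
    simp at h
    omega
  · omega

theorem exists_eq_vtx (ht : 0 < t) (hℓ : ∀ i, 1 ≤ ℓ i) (v : Vtx t ℓ) :
    ∃ i j, j ≤ ℓ i ∧ v = vtx t ℓ i j := by
  rcases v with _ | _ | ⟨i, a⟩
  · exact ⟨⟨0, ht⟩, 0, by omega, (vtx_zero _).symm⟩
  · exact ⟨⟨0, ht⟩, _, le_rfl, (vtx_length _ (hℓ _)).symm⟩
  · refine ⟨i, a + 1, by omega, ?_⟩
    simp [vtx, a.2]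

variable {k : Type u} [Field k]

theorem eV_mul_eV (v w : Vtx t ℓ) :
    (eV v * eV w : PathAlg k t ℓ) = if v = w then eV v else 0 := by
  apply Subtype.ext
  refine LinearMap.ext fun f => funext fun p => ?_
  by_cases h : v = w
  · subst h
    by_cases hp : startIdx p = v <;> simp [eV, Ev, hp]
  · by_cases hp : startIdx p = v
    · subst hp
      simp [eV, Ev, h]
    · simp [eV, Ev, h, hp]

theorem sum_eV : (∑ v, eV v : PathAlg k t ℓ) = 1 := by
  apply Subtype.ext
  ext f p
  simp [eV, Ev, Finset.sum_apply]

theorem strip_eq_some {i : Fin t} {j : ℕ} {p q : PIdx t ℓ} (h : strip i j p = some q) :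
    startIdx p = vtx t ℓ i j ∧ startIdx q = vtx t ℓ i (j + 1) ∧ j < ℓ i := by
  rcases p with v | ⟨i', a, b, hab, hb⟩
  · simp [strip] at h
  · simp only [strip] at h
    split_ifs at h with h₁ h₂
    · obtain ⟨rfl, rfl⟩ := h₁
      obtain rfl := Option.some.inj h
      exact ⟨rfl, rfl, by omega⟩
    · obtain ⟨rfl, rfl⟩ := h₁
      obtain rfl := Option.some.inj h
      obtain rfl : b = a + 1 := by omega
      exact ⟨rfl, rfl, by omega⟩

theorem eV_mul_arE (i : Fin t) (j : ℕ) :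
    (eV (vtx t ℓ i j) * arE i j : PathAlg k t ℓ) = arE i j := by
  apply Subtype.ext
  refine LinearMap.ext fun f => funext fun p => ?_
  simp only [eV, arE, Ev, Ar, MulMemClass.coe_mul, Module.End.mul_apply, LinearMap.coe_mk,
    AddHom.coe_mk]
  rcases h : strip i j p with _ | q
  · simp
  · rw [if_pos (strip_eq_some h).1]

theorem arE_mul_eV (i : Fin t) (j : ℕ) :
    (arE i j * eV (vtx t ℓ i (j + 1)) : PathAlg k t ℓ) = arE i j := by
  apply Subtype.ext
  refine LinearMap.ext fun f => funext fun p => ?_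
  simp only [eV, arE, Ev, Ar, MulMemClass.coe_mul, Module.End.mul_apply, LinearMap.coe_mk,
    AddHom.coe_mk]
  rcases h : strip i j p with _ | q
  · rfl
  · simp [(strip_eq_some h).2.1]

theorem arE_eq_zero {i : Fin t} {j : ℕ} (hj : ℓ i ≤ j) : (arE i j : PathAlg k t ℓ) = 0 := by
  apply Subtype.ext
  refine LinearMap.ext fun f => funext fun p => ?_
  simp only [arE, Ar, LinearMap.coe_mk, AddHom.coe_mk]
  rcases h : strip i j p with _ | q
  · rfl
  · exact absurd (strip_eq_some h).2.2 (by omega)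

end PathAlgebra

section Modules

variable {k : Type u} [Field k] (T : ToupieAlg k)

theorem e0_mul_mul_einf (hm : mDim T = 0) (x : Alg T) : e0 T * x * einf T = 0 := by
  have : Module.Finite k (Alg T) := by
    let f : PathAlg k T.t T.ℓ →ₗ[k] Alg T :=
      { toFun := mkA T
        map_add' := map_add _
        map_smul' := fun c x => by
          rw [Algebra.smul_def, map_mul, RingHom.id_apply, Algebra.smul_def]
          rfl }
    exact Module.Finite.of_surjective f (mkA_surjective T)
  have h := Submodule.finrank_eq_zero.1 hm
  have hx : lrMap T x ∈ LinearMap.range (lrMap T) := ⟨x, rfl⟩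
  rwa [h, Submodule.mem_bot] at hx

/-- The action of the `j`-th arrow of branch `i` on right `A`-modules. -/
def actAr (i : Fin T.t) (j : ℕ) : (Alg T)ᵐᵒᵖ := op (mkA T (arE i j))

theorem actV_mul_actV (v w : Vtx T.t T.ℓ) :
    actV T v * actV T w = if v = w then actV T v else 0 := by
  rw [actV, actV, ← op_mul, ← map_mul, eV_mul_eV]
  split_ifs with h₁ h₂ h₂
  · rw [h₁]
  · exact absurd h₁.symm h₂
  · exact absurd h₂.symm h₁
  · simp

theorem actAr_mul_actV (i : Fin T.t) (j : ℕ) :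
    actAr T i j * actV T (vtx T.t T.ℓ i j) = actAr T i j := by
  rw [actV, actAr, ← op_mul, ← map_mul, eV_mul_arE]

theorem actV_mul_actAr (i : Fin T.t) (j : ℕ) :
    actV T (vtx T.t T.ℓ i (j + 1)) * actAr T i j = actAr T i j := by
  rw [actV, actAr, ← op_mul, ← map_mul, arE_mul_eV]

theorem actAr_eq_zero {i : Fin T.t} {j : ℕ} (hj : T.ℓ i ≤ j) : actAr T i j = 0 := by
  rw [actAr, arE_eq_zero hj, map_zero, op_zero]

theorem sum_actV : ∑ v, actV T v = 1 := by
  simp only [actV]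
  rw [← op_one, ← map_one (mkA T), ← sum_eV, map_sum, Finset.op_sum]

theorem actV_snk_mul_mul_actV_src (hm : mDim T = 0) (b : (Alg T)ᵐᵒᵖ) :
    actV T .snk * b * actV T .src = 0 := by
  apply unop_injective
  simpa [mul_assoc, e0, einf, actV] using e0_mul_mul_einf T hm b.unop

variable {M : Type u} [AddCommGroup M] [Module (Alg T)ᵐᵒᵖ M]

theorem actV_smul_actV_smul (v w : Vtx T.t T.ℓ) (x : M) :
    actV T v • actV T w • x = if v = w then actV T v • x else 0 := by
  rw [← mul_smul, actV_mul_actV]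
  split_ifs <;> simp

theorem actAr_smul_actV_smul (i : Fin T.t) (j : ℕ) (w : Vtx T.t T.ℓ) (x : M) :
    actAr T i j • actV T w • x = if vtx T.t T.ℓ i j = w then actAr T i j • x else 0 := by
  rw [← actAr_mul_actV, mul_smul, actV_smul_actV_smul]
  split_ifs <;> simp [mul_smul]

theorem actV_smul_actAr_smul (i : Fin T.t) (j : ℕ) (w : Vtx T.t T.ℓ) (x : M) :
    actV T w • actAr T i j • x = if w = vtx T.t T.ℓ i (j + 1) then actAr T i j • x else 0 := by
  rw [← actV_mul_actAr, mul_smul, actV_smul_actV_smul]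
  split_ifs with h
  · rw [h]
  · rfl

theorem sum_actV_smul (x : M) : ∑ v, actV T v • x = x := by
  rw [← Finset.sum_smul, sum_actV, one_smul]

variable (M)

/-- The submodule of `M` generated by the space `M_0` at the source. -/
def srcSpan : Submodule (Alg T)ᵐᵒᵖ M :=
  Submodule.span _ (Set.range fun x : M => actV T .src • x)

/-- The largest submodule of `M` that vanishes at the sink. -/
def snkKer : Submodule (Alg T)ᵐᵒᵖ M where
  carrier := {x | ∀ b : (Alg T)ᵐᵒᵖ, actV T .snk • b • x = 0}
  zero_mem' b := by simp
  add_mem' {x y} hx hy b := by simp [hx b, hy b]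
  smul_mem' c x hx b := by rw [← mul_smul b c x]; exact hx (b * c)

variable {T M}

theorem actV_src_smul_mem_srcSpan (x : M) : actV T .src • x ∈ srcSpan T M :=
  Submodule.subset_span ⟨x, rfl⟩

theorem actV_snk_smul_eq_zero {x : M} (hx : x ∈ snkKer T M) : actV T .snk • x = 0 := by
  simpa using hx 1

theorem actV_src_smul_mem_snkKer (hm : mDim T = 0) (x : M) : actV T .src • x ∈ snkKer T M := by
  intro b
  rw [← mul_smul, ← mul_smul, actV_snk_mul_mul_actV_src T hm, zero_smul]

theorem srcSpan_le_snkKer (hm : mDim T = 0) : srcSpan T M ≤ snkKer T M := by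
  refine Submodule.span_le.2 ?_
  rintro _ ⟨x, rfl⟩
  exact actV_src_smul_mem_snkKer hm x

theorem eq_bot_or_eq_top_of_isCompl {R : Type u} [Ring R] {X : ModuleCat.{u} R} (hX : Indec R X)
    {N N' : Submodule R X} (h : IsCompl N N') : N = ⊥ ∨ N = ⊤ := by
  rcases hX.2 _ (Submodule.isIdempotentElem_projection h) with h₀ | h₁
  · left
    rw [← Submodule.range_projection h, h₀, LinearMap.range_zero]
  · right
    rw [← Submodule.range_projection h, h₁, LinearMap.range_id]

variable [Module k M] [IsScalarTower k (Alg T)ᵐᵒᵖ M]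

theorem smul_mem_of_generators (W : Submodule k M) (hV : ∀ v, ∀ x ∈ W, actV T v • x ∈ W)
    (hA : ∀ i j, ∀ x ∈ W, actAr T i j • x ∈ W) (b : (Alg T)ᵐᵒᵖ) (x : M) (hx : x ∈ W) :
    b • x ∈ W := by
  obtain ⟨a, rfl⟩ := op_surjective b
  obtain ⟨⟨y, hy⟩, rfl⟩ := mkA_surjective T a
  induction hy using Algebra.adjoin_induction generalizing x with
  | mem y hy =>
    rcases hy with ⟨v, rfl⟩ | ⟨i, j, rfl⟩
    · exact hV v x hx
    · exact hA i j x hx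
  | algebraMap c =>
    have : op (mkA T (algebraMap k (PathAlg k T.t T.ℓ) c)) • x = c • x := by
      rw [← algebraMap_smul (Alg T)ᵐᵒᵖ c x]
      rfl
    exact this ▸ W.smul_mem c hx
  | add y z hy hz ihy ihz =>
    have : op (mkA T ⟨y + z, add_mem hy hz⟩) • x =
        op (mkA T ⟨y, hy⟩) • x + op (mkA T ⟨z, hz⟩) • x := by
      rw [← add_smul, ← op_add, ← map_add]
      rfl
    exact this ▸ add_mem (ihy x hx) (ihz x hx)
  | mul y z hy hz ihy ihz =>
    have : op (mkA T ⟨y * z, mul_mem hy hz⟩) • x =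
        op (mkA T ⟨z, hz⟩) • op (mkA T ⟨y, hy⟩) • x := by
      rw [← mul_smul, ← op_mul, ← map_mul]
      rfl
    exact this ▸ ihz _ (ihy x hx)

/-- The space of the representation `M` at the vertex `v`. -/
def vtxSpace (k : Type u) [Field k] (T : ToupieAlg k) (M : Type u) [AddCommGroup M]
    [Module (Alg T)ᵐᵒᵖ M] [Module k M] [IsScalarTower k (Alg T)ᵐᵒᵖ M] (v : Vtx T.t T.ℓ) :
    Submodule k M :=
  LinearMap.range (Algebra.lsmul k k M (actV T v))

theorem mem_vtxSpace {v : Vtx T.t T.ℓ} {x : M} : x ∈ vtxSpace k T M v ↔ actV T v • x = x := by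
  refine ⟨?_, fun h => ⟨x, h⟩⟩
  rintro ⟨y, rfl⟩
  change actV T v • actV T v • y = actV T v • y
  rw [actV_smul_actV_smul, if_pos rfl]

theorem actV_smul_mem_vtxSpace (v : Vtx T.t T.ℓ) (x : M) : actV T v • x ∈ vtxSpace k T M v :=
  ⟨x, rfl⟩

theorem actAr_smul_mem_vtxSpace (i : Fin T.t) (j : ℕ) (x : M) :
    actAr T i j • x ∈ vtxSpace k T M (vtx T.t T.ℓ i (j + 1)) := by
  rw [mem_vtxSpace, actV_smul_actAr_smul, if_pos rfl]

theorem actV_smul_eq_zero_of_ne {v w : Vtx T.t T.ℓ} (h : v ≠ w) {x : M}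
    (hx : x ∈ vtxSpace k T M w) : actV T v • x = 0 := by
  rw [← mem_vtxSpace.1 hx, actV_smul_actV_smul, if_neg h]

theorem actAr_smul_eq_zero_of_ne {i : Fin T.t} {j : ℕ} {w : Vtx T.t T.ℓ}
    (h : vtx T.t T.ℓ i j ≠ w) {x : M} (hx : x ∈ vtxSpace k T M w) : actAr T i j • x = 0 := by
  rw [← mem_vtxSpace.1 hx, actAr_smul_actV_smul, if_neg h]

/-- The part of the submodule `N` at the `j`-th vertex of branch `i`. -/
def branchPart (k : Type u) [Field k] {T : ToupieAlg k} {M : Type u} [AddCommGroup M]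
    [Module (Alg T)ᵐᵒᵖ M] [Module k M] [IsScalarTower k (Alg T)ᵐᵒᵖ M]
    (N : Submodule (Alg T)ᵐᵒᵖ M) (i : Fin T.t) (j : ℕ) : Submodule k M :=
  vtxSpace k T M (vtx T.t T.ℓ i j) ⊓ N.restrictScalars k

theorem exists_isCompl_of_branchwise {N : Submodule (Alg T)ᵐᵒᵖ M}
    (hsrc : ∀ x, actV T .src • x ∈ N) (hsnk : ∀ x ∈ N, actV T .snk • x = 0)
    (hbr : ∀ i, ∃ C : ℕ → Submodule k M,
      (∀ j ≤ T.ℓ i, C j ⊓ branchPart k N i j = ⊥ ∧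
        C j ⊔ branchPart k N i j = vtxSpace k T M (vtx T.t T.ℓ i j)) ∧
      ∀ j < T.ℓ i, (C j).map (Algebra.lsmul k k M (actAr T i j)) ≤ C (j + 1)) :
    ∃ N' : Submodule (Alg T)ᵐᵒᵖ M, IsCompl N N' := by
  choose C hC hCα using hbr
  have hCV : ∀ i j, j ≤ T.ℓ i → C i j ≤ vtxSpace k T M (vtx T.t T.ℓ i j) := fun i j hj =>
    (hC i j hj).2 ▸ le_sup_left
  have hC0 : ∀ i, C i 0 = ⊥ := fun i => by
    rw [eq_bot_iff, ← (hC i 0 (Nat.zero_le _)).1]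
    refine fun x hx => ⟨hx, hCV i 0 (Nat.zero_le _) hx, ?_⟩
    have := mem_vtxSpace.1 (hCV i 0 (Nat.zero_le _) hx)
    rw [vtx_zero] at this
    exact this ▸ hsrc x
  have hCl : ∀ i, C i (T.ℓ i) = vtxSpace k T M .snk := fun i => by
    have h := (hC i _ le_rfl).2
    have hbot : branchPart k N i (T.ℓ i) = ⊥ := by
      refine (Submodule.eq_bot_iff _).2 fun x hx => ?_
      have := mem_vtxSpace.1 hx.1
      rw [vtx_length _ (T.hℓ i)] at this
      exact this ▸ hsnk x hx.2
    rwa [hbot, sup_bot_eq, vtx_length _ (T.hℓ i)] at h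
  have hCeq : ∀ i i' j j', j ≤ T.ℓ i → j' ≤ T.ℓ i' →
      vtx T.t T.ℓ i j = vtx T.t T.ℓ i' j' → C i j = C i' j' := by
    intro i i' j j' hj hj' h
    rcases vtx_eq_vtx hj hj' h with ⟨rfl, rfl⟩ | ⟨rfl, rfl⟩ | ⟨rfl, rfl⟩
    · rfl
    · rw [hC0, hC0]
    · rw [hCl, hCl]
  let W : Submodule k M :=
    ⨅ i, ⨅ j, ⨅ _ : j ≤ T.ℓ i, (C i j).comap (Algebra.lsmul k k M (actV T (vtx T.t T.ℓ i j)))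
  have hW : ∀ x, x ∈ W ↔ ∀ i j, j ≤ T.ℓ i → actV T (vtx T.t T.ℓ i j) • x ∈ C i j := fun x => by
    simp [W, Submodule.mem_iInf]
  have hCW : ∀ i j, j ≤ T.ℓ i → C i j ≤ W := by
    intro i j hj x hx
    refine (hW x).2 fun i' j' hj' => ?_
    by_cases h : vtx T.t T.ℓ i' j' = vtx T.t T.ℓ i j
    · rw [h, mem_vtxSpace.1 (hCV i j hj hx), hCeq i' i j' j hj' hj h]
      exact hx
    · rw [actV_smul_eq_zero_of_ne h (hCV i j hj hx)]
      exact zero_mem _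
  have hv : ∀ v : Vtx T.t T.ℓ, ∃ i j, j ≤ T.ℓ i ∧ v = vtx T.t T.ℓ i j :=
    exists_eq_vtx (by have := T.ht; omega) T.hℓ
  have hstable := smul_mem_of_generators W
    (by
      intro v x hx
      obtain ⟨i, j, hj, rfl⟩ := hv v
      exact hCW i j hj ((hW x).1 hx i j hj))
    (by
      intro i j x hx
      by_cases hj : j < T.ℓ i
      · refine hCW i (j + 1) hj (hCα i j hj ⟨_, (hW x).1 hx i j hj.le, ?_⟩)
        simp [← mul_smul, actAr_mul_actV]
      · rw [actAr_eq_zero T (not_lt.1 hj), zero_smul]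
        exact zero_mem _)
  refine ⟨{ W with smul_mem' := fun b x hx => hstable b x hx }, ?_, ?_⟩
  · rw [Submodule.disjoint_def]
    intro x hx (hx' : x ∈ W)
    rw [← sum_actV_smul T x]
    refine Finset.sum_eq_zero fun v _ => ?_
    obtain ⟨i, j, hj, rfl⟩ := hv v
    have : actV T (vtx T.t T.ℓ i j) • x ∈ C i j ⊓ branchPart k N i j :=
      ⟨(hW x).1 hx' i j hj, actV_smul_mem_vtxSpace _ x, N.smul_mem _ hx⟩
    rwa [(hC i j hj).1] at this
  · rw [codisjoint_iff, eq_top_iff]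
    intro x _
    rw [← sum_actV_smul T x]
    refine sum_mem fun v _ => ?_
    obtain ⟨i, j, hj, rfl⟩ := hv v
    have : actV T (vtx T.t T.ℓ i j) • x ∈ C i j ⊔ branchPart k N i j :=
      (hC i j hj).2 ▸ actV_smul_mem_vtxSpace _ x
    obtain ⟨c, hc, g, hg, hcg⟩ := Submodule.mem_sup.1 this
    rw [← hcg]
    exact add_mem (Submodule.mem_sup_right (hCW i j hj hc)) (Submodule.mem_sup_left hg.2)

theorem branchPart_srcSpan_succ_le (hm : mDim T = 0) (i : Fin T.t) (j : ℕ) (hj : j < T.ℓ i) :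
    branchPart k (srcSpan T M) i (j + 1) ≤
      (branchPart k (srcSpan T M) i j).map (Algebra.lsmul k k M (actAr T i j)) := by
  rintro x ⟨hx, hxN⟩
  replace hx := mem_vtxSpace.1 hx
  rcases Nat.eq_or_lt_of_le (Nat.succ_le_of_lt hj) with h | h
  · rw [← Nat.succ_eq_add_one, h, vtx_length _ (T.hℓ i),
      actV_snk_smul_eq_zero (srcSpan_le_snkKer hm hxN)] at hx
    exact hx ▸ zero_mem _
  · let P : Submodule k M :=
      (branchPart k (srcSpan T M) i j).map (Algebra.lsmul k k M (actAr T i j))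
    let W : Submodule k M := P.comap (Algebra.lsmul k k M (actV T (vtx T.t T.ℓ i (j + 1)))) ⊓
      (srcSpan T M).restrictScalars k
    have hmem : ∀ y, y ∈ W ↔ actV T (vtx T.t T.ℓ i (j + 1)) • y ∈ P ∧ y ∈ srcSpan T M :=
      fun y => Iff.rfl
    have hstable := smul_mem_of_generators W
      (by
        intro v y hy
        refine (hmem _).2 ⟨?_, Submodule.smul_mem _ _ hy.2⟩
        rw [actV_smul_actV_smul]
        split_ifs
        exacts [hy.1, zero_mem _])
      (by
        intro i' j' y hy
        refine (hmem _).2 ⟨?_, Submodule.smul_mem _ _ hy.2⟩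
        by_cases hj' : j' < T.ℓ i'
        · rw [actV_smul_actAr_smul]
          split_ifs with he
          · obtain ⟨rfl, rfl⟩ : i = i' ∧ j = j' := by
              rcases vtx_eq_vtx hj hj' he with ⟨h₁, h₂⟩ | h₁ | h₁
              · exact ⟨h₁, by omega⟩
              · omega
              · omega
            refine ⟨actV T (vtx T.t T.ℓ i j) • y,
              ⟨actV_smul_mem_vtxSpace _ y, (srcSpan T M).smul_mem _ hy.2⟩, ?_⟩
            change actAr T i j • actV T (vtx T.t T.ℓ i j) • y = _
            rw [actAr_smul_actV_smul, if_pos rfl]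
          · exact zero_mem _
        · rw [actAr_eq_zero T (not_lt.1 hj'), zero_smul, smul_zero]
          exact zero_mem _)
    have hle : srcSpan T M ≤ { W with smul_mem' := fun b y hy => hstable b y hy } := by
      refine Submodule.span_le.2 ?_
      rintro _ ⟨y, rfl⟩
      refine (hmem _).2 ⟨?_, actV_src_smul_mem_srcSpan y⟩
      have hne : vtx T.t T.ℓ i (j + 1) ≠ .src := by
        rw [← vtx_zero i]
        intro he
        rcases vtx_eq_vtx hj (Nat.zero_le _) he with h₁ | h₁ | h₁ <;> omega
      rw [actV_smul_actV_smul, if_neg hne]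
      exact zero_mem _
    exact hx ▸ (hle hxN).1

theorem branchPart_snkKer_comap_le (hm : mDim T = 0) (i : Fin T.t) (j : ℕ) (hj : j < T.ℓ i) :
    vtxSpace k T M (vtx T.t T.ℓ i j) ⊓
      (branchPart k (snkKer T M) i (j + 1)).comap (Algebra.lsmul k k M (actAr T i j)) ≤
      branchPart k (snkKer T M) i j := by
  rintro x ⟨hx, -, hxα⟩
  refine ⟨hx, ?_⟩
  change actAr T i j • x ∈ snkKer T M at hxα
  change x ∈ snkKer T M
  rcases Nat.eq_zero_or_pos j with rfl | hpos
  · replace hx := mem_vtxSpace.1 hx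
    rw [vtx_zero] at hx
    exact hx ▸ actV_src_smul_mem_snkKer hm x
  · let U : Submodule k M := Submodule.span k {x} ⊔ (snkKer T M).restrictScalars k
    have hU : ∀ y ∈ U, ∃ c : k, ∃ z ∈ snkKer T M, c • x + z = y := by
      intro y hy
      obtain ⟨w, hw, z, hz, rfl⟩ := Submodule.mem_sup.1 hy
      obtain ⟨c, rfl⟩ := Submodule.mem_span_singleton.1 hw
      exact ⟨c, z, hz, rfl⟩
    have hxU : x ∈ U := Submodule.mem_sup_left (Submodule.mem_span_singleton_self x)
    have hgen : ∀ b : (Alg T)ᵐᵒᵖ, b • x ∈ U → ∀ y ∈ U, b • y ∈ U := by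
      intro b hb y hy
      obtain ⟨c, z, hz, rfl⟩ := hU y hy
      rw [smul_add, smul_comm]
      exact add_mem (U.smul_mem c hb) (Submodule.mem_sup_right (Submodule.smul_mem _ b hz))
    have hstable := smul_mem_of_generators U
      (by
        refine fun v => hgen _ ?_
        by_cases he : v = vtx T.t T.ℓ i j
        · rwa [he, mem_vtxSpace.1 hx]
        · rw [actV_smul_eq_zero_of_ne he hx]
          exact zero_mem _)
      (by
        refine fun i' j' => hgen _ ?_
        by_cases hj' : j' < T.ℓ i'
        · by_cases he : vtx T.t T.ℓ i' j' = vtx T.t T.ℓ i j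
          · obtain ⟨rfl, rfl⟩ : i' = i ∧ j' = j := by
              rcases vtx_eq_vtx hj'.le hj.le he with h₁ | h₁ | h₁
              · exact h₁
              · omega
              · omega
            exact Submodule.mem_sup_right hxα
          · rw [actAr_smul_eq_zero_of_ne he hx]
            exact zero_mem _
        · rw [actAr_eq_zero T (not_lt.1 hj'), zero_smul]
          exact zero_mem _)
    have hne : Vtx.snk ≠ vtx T.t T.ℓ i j := by
      rw [← vtx_length i (T.hℓ i)]
      intro he
      rcases vtx_eq_vtx le_rfl hj.le he with h₁ | h₁ | h₁ <;> omega
    intro b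
    obtain ⟨c, z, hz, h⟩ := hU _ (hstable b x hxU)
    rw [← h, smul_add, smul_comm, actV_smul_eq_zero_of_ne hne hx, actV_snk_smul_eq_zero hz,
      smul_zero, add_zero]

theorem map_actAr_vtxSpace_le (i : Fin T.t) (j : ℕ) :
    (vtxSpace k T M (vtx T.t T.ℓ i j)).map (Algebra.lsmul k k M (actAr T i j)) ≤
      vtxSpace k T M (vtx T.t T.ℓ i (j + 1)) := by
  rintro _ ⟨x, -, rfl⟩
  exact actAr_smul_mem_vtxSpace i j x

theorem exists_isCompl_srcSpan (k : Type u) [Field k] {T : ToupieAlg k} (hm : mDim T = 0)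
    (M : Type u) [AddCommGroup M] [Module (Alg T)ᵐᵒᵖ M] :
    ∃ N' : Submodule (Alg T)ᵐᵒᵖ M, IsCompl (srcSpan T M) N' := by
  let _ : Module k M := Module.compHom M (algebraMap k (Alg T)ᵐᵒᵖ)
  have : IsScalarTower k (Alg T)ᵐᵒᵖ M := IsScalarTower.of_algebraMap_smul fun _ _ => rfl
  exact exists_isCompl_of_branchwise (k := k) actV_src_smul_mem_srcSpan
    (fun x hx => actV_snk_smul_eq_zero (srcSpan_le_snkKer hm hx))
    fun i => exists_chain_compl_of_le_map (T.ℓ i) _ _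
      (fun j => Algebra.lsmul k k M (actAr T i j)) (fun _ _ => inf_le_left)
      (fun j _ => map_actAr_vtxSpace_le i j) (branchPart_srcSpan_succ_le hm i)

theorem exists_isCompl_snkKer (k : Type u) [Field k] {T : ToupieAlg k} (hm : mDim T = 0)
    (M : Type u) [AddCommGroup M] [Module (Alg T)ᵐᵒᵖ M] :
    ∃ N' : Submodule (Alg T)ᵐᵒᵖ M, IsCompl (snkKer T M) N' := by
  let _ : Module k M := Module.compHom M (algebraMap k (Alg T)ᵐᵒᵖ)
  have : IsScalarTower k (Alg T)ᵐᵒᵖ M := IsScalarTower.of_algebraMap_smul fun _ _ => rfl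
  refine exists_isCompl_of_branchwise (k := k) (actV_src_smul_mem_snkKer hm)
    (fun x hx => actV_snk_smul_eq_zero hx) fun i => ?_
  obtain ⟨C₀, -, h₁, h₂⟩ := exists_relative_compl_extending
    (disjoint_bot_left (a := branchPart k (snkKer T M) i 0)) bot_le inf_le_left
  obtain ⟨C, -, hC⟩ := exists_chain_compl_of_comap_le (T.ℓ i)
    (fun j => vtxSpace k T M (vtx T.t T.ℓ i j)) (branchPart k (snkKer T M) i)
    (fun j => Algebra.lsmul k k M (actAr T i j)) C₀ (fun _ _ => inf_le_left)
    (fun j _ => map_actAr_vtxSpace_le i j) (branchPart_snkKer_comap_le hm i) h₁ h₂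
  exact ⟨C, hC⟩

end Modules

end Toupie

namespace Toupie

/-- Let `A = kQ/I` be a non simply connected toupie algebra with
`dim_k e₀ A e∞ = 0` and let `M` be an indecomposable (finite-dimensional right)
`A`-module, viewed as a representation of `(Q, I)`.  If `M_0 ≠ 0` then the top of `M`
is a direct sum of copies of the simple module `S_0` at the source, and if `M_∞ ≠ 0`
then the socle of `M` is a direct sum of copies of the simple module `S_∞` at the sink. -/
theorem top_src_and_soc_snk {k : Type u} [Field k] (T : ToupieAlg k)
    (hnsc : ¬ SimplyConnected T) (hm : mDim T = 0)
    (M : ModuleCat.{u} (Alg T)ᵐᵒᵖ) (hind : Indec (Alg T)ᵐᵒᵖ M) (hfd : FdMod (Alg T)ᵐᵒᵖ M) :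
    (¬ VanishAt T M Vtx.src → TopIn T M {Vtx.src}) ∧
      (¬ VanishAt T M Vtx.snk → SocIn T M {Vtx.snk}) := by
  constructor
  · intro h N hN
    obtain ⟨N', hN'⟩ := exists_isCompl_srcSpan k hm M
    rcases eq_bot_or_eq_top_of_isCompl hind hN' with hG | hG
    · refine absurd (fun m => ?_) h
      exact (Submodule.mem_bot _).1 (hG ▸ actV_src_smul_mem_srcSpan m)
    · refine ⟨_, rfl, ?_⟩
      by_contra! hc
      refine hN.1 (top_le_iff.1 (hG ▸ Submodule.span_le.2 ?_))
      rintro _ ⟨m, rfl⟩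
      exact hc m
  · intro h N hN
    obtain ⟨N', hN'⟩ := exists_isCompl_snkKer k hm M
    rcases eq_bot_or_eq_top_of_isCompl hind hN' with hK | hK
    · refine ⟨_, rfl, ?_⟩
      by_contra! hc
      refine hN.1 (le_bot_iff.1 (hK ▸ fun m hm' b => ?_))
      exact hc _ (N.smul_mem b hm')
    · refine absurd (fun m => ?_) h
      exact actV_snk_smul_eq_zero (hK ▸ Submodule.mem_top)

end Toupie
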